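/- arXiv:2308.08691 — 2 statements merged into one kernel-verified Lean document; each statement's English description precedes it below -/
import Mathlib

section
/- Let A and B be n×n real symmetric positive semidefinite matrices. Then 0 ≤ trace((A·B)·(A·B)) ≤ (trace(A·B))². -/
open Matrix

/-- The Frobenius inner product bound `tr (S²) ≤ (tr S)²` for positive semidefinite `S`. -/
lemma Matrix.PosSemidef.trace_mul_self_le_sq_trace {ι : Type*} [Fintype ι]
    {S : Matrix ι ι ℝ} (hS : S.PosSemidef) : (S * S).trace ≤ S.trace ^ 2 := by
  classical
  have hdiag : S * S = Unitary.conjStarAlgAut ℝ _ hS.1.eigenvectorUnitary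
      (diagonal fun i => hS.1.eigenvalues i ^ 2) := by
    conv_lhs => rw [hS.1.spectral_theorem, ← map_mul, diagonal_mul_diagonal]
    simp [pow_two]
  have htrace : (S * S).trace = ∑ i, hS.1.eigenvalues i ^ 2 := by
    rw [hdiag, Unitary.conjStarAlgAut_apply, trace_mul_cycle, Unitary.coe_star_mul_self, one_mul,
      trace_diagonal]
  rw [htrace, hS.1.trace_eq_sum_eigenvalues]
  exact Finset.sum_sq_le_sq_sum_of_nonneg fun i _ => hS.eigenvalues_nonneg i

/-- For real symmetric positive semidefinite `n×n` matrices `A`, `B`, the trace of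
`(A·B)²` is nonnegative and bounded by `(trace (A·B))²`. -/
theorem trace_sq_prod_posSemidef_le
    (n : ℕ) (A B : Matrix (Fin n) (Fin n) ℝ)
    (hA : A.PosSemidef) (hB : B.PosSemidef) :
    0 ≤ ((A * B) * (A * B)).trace ∧ ((A * B) * (A * B)).trace ≤ ((A * B).trace) ^ 2 := by
  obtain ⟨C, rfl⟩ : ∃ C, A = Cᴴ * C := by
    open scoped MatrixOrder Matrix.Norms.L2Operator in
      exact CStarAlgebra.nonneg_iff_eq_star_mul_self.mp hA.nonneg
  have hS := hB.mul_mul_conjTranspose_same C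
  have h₁ : (Cᴴ * C * B).trace = (C * B * Cᴴ).trace := by
    rw [Matrix.mul_assoc, trace_mul_comm]
  have h₂ : (Cᴴ * C * B * (Cᴴ * C * B)).trace = (C * B * Cᴴ * (C * B * Cᴴ)).trace := by
    rw [Matrix.mul_assoc Cᴴ C B, Matrix.mul_assoc Cᴴ, trace_mul_comm]
    simp only [Matrix.mul_assoc]
  rw [h₁, h₂]
  refine ⟨?_, hS.trace_mul_self_le_sq_trace⟩
  simpa [pow_two] using (hS.pow 2).trace_nonneg
end

section
/- Let v > 0, let η be a real random variable distributed according to the centered Gaussian measure with mean 0 and variance v, and let c < 0 be a real number. Define the random fidelity F = 1 + c·η². Then E[F] = 1 + c·v < 1, the standard deviation of F equals √2·|c|·v, and consequently the ratio (standard deviation of F)/(1 − E[F]) equals √2 exactly. -/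
open MeasureTheory ProbabilityTheory
open scoped NNReal

lemma hasDerivAt_mul_exp_mul_sq_div_two {p : ℝ → ℝ} {p' : ℝ} (a t : ℝ) (hp : HasDerivAt p p' t) :
    HasDerivAt (fun s ↦ p s * Real.exp (a * s ^ 2 / 2))
      ((p' + a * t * p t) * Real.exp (a * t ^ 2 / 2)) t := by
  have h : HasDerivAt (fun s : ℝ ↦ a * s ^ 2 / 2) (a * t) t := by
    refine (((hasDerivAt_pow 2 t).const_mul a).div_const 2).congr_deriv ?_
    push_cast
    ring
  refine (hp.fun_mul h.exp).congr_deriv ?_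
  ring

lemma iteratedDeriv_four_exp_mul_sq_div_two_zero (a : ℝ) :
    iteratedDeriv 4 (fun t : ℝ ↦ Real.exp (a * t ^ 2 / 2)) 0 = 3 * a ^ 2 := by
  have d₁ : deriv (fun t : ℝ ↦ Real.exp (a * t ^ 2 / 2)) =
      fun t ↦ a * t * Real.exp (a * t ^ 2 / 2) := by
    ext t
    simpa using (hasDerivAt_mul_exp_mul_sq_div_two a t (hasDerivAt_const t (1 : ℝ))).deriv
  have d₂ : deriv (fun t : ℝ ↦ a * t * Real.exp (a * t ^ 2 / 2)) =
      fun t ↦ (a + a ^ 2 * t ^ 2) * Real.exp (a * t ^ 2 / 2) := by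
    ext t
    rw [(hasDerivAt_mul_exp_mul_sq_div_two a t ((hasDerivAt_id' t).const_mul a)).deriv]
    ring
  have d₃ : deriv (fun t : ℝ ↦ (a + a ^ 2 * t ^ 2) * Real.exp (a * t ^ 2 / 2)) =
      fun t ↦ (3 * a ^ 2 * t + a ^ 3 * t ^ 3) * Real.exp (a * t ^ 2 / 2) := by
    ext t
    rw [(hasDerivAt_mul_exp_mul_sq_div_two a t
      (((hasDerivAt_pow 2 t).const_mul (a ^ 2)).const_add a)).deriv]
    push_cast
    ring
  have d₄ : deriv (fun t : ℝ ↦ (3 * a ^ 2 * t + a ^ 3 * t ^ 3) * Real.exp (a * t ^ 2 / 2)) 0 =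
      3 * a ^ 2 := by
    rw [(hasDerivAt_mul_exp_mul_sq_div_two a 0 (((hasDerivAt_id' 0).const_mul (3 * a ^ 2)).fun_add
      ((hasDerivAt_pow 3 0).const_mul (a ^ 3)))).deriv]
    simp
  simp only [iteratedDeriv_succ, iteratedDeriv_zero, d₁, d₂, d₃, d₄]

lemma integral_sq_gaussianReal_zero (v : ℝ≥0) : ∫ x, x ^ 2 ∂(gaussianReal 0 v) = v := by
  have h := variance_eq_sub (memLp_id_gaussianReal (μ := 0) (v := v) 2)
  simpa using h.symm

lemma integral_pow_four_gaussianReal_zero (v : ℝ≥0) :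
    ∫ x, x ^ 4 ∂(gaussianReal 0 v) = 3 * (v : ℝ) ^ 2 := by
  have h := iteratedDeriv_mgf_zero (X := id) (μ := gaussianReal 0 v)
    (by simp [integrableExpSet_id_gaussianReal]) 4
  rw [mgf_id_gaussianReal] at h
  simpa [iteratedDeriv_four_exp_mul_sq_div_two_zero] using h.symm

lemma memLp_sq_gaussianReal (μ : ℝ) (v : ℝ≥0) :
    MemLp (fun x : ℝ ↦ x ^ 2) 2 (gaussianReal μ v) := by
  rw [memLp_two_iff_integrable_sq (by fun_prop)]
  simpa [← pow_mul] using integrable_pow_of_mem_interior_integrableExpSet (X := id)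
    (μ := gaussianReal μ v) (by simp [integrableExpSet_id_gaussianReal]) 4

lemma variance_sq_gaussianReal_zero (v : ℝ≥0) :
    variance (fun x : ℝ ↦ x ^ 2) (gaussianReal 0 v) = 2 * (v : ℝ) ^ 2 := by
  rw [variance_eq_sub (memLp_sq_gaussianReal 0 v)]
  simp only [Pi.pow_apply, ← pow_mul, integral_sq_gaussianReal_zero]
  norm_num [integral_pow_four_gaussianReal_zero]
  ring

/-- Let `η` be distributed according to the centered Gaussian measure with mean `0` and
variance `v > 0`, let `c < 0`, and let `F = 1 + c·η²` be the random fidelity. Then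
`E[F] = 1 + c·v < 1`, the standard deviation of `F` is `√2·|c|·v`, and the ratio
`(std of F)/(1 − E[F])` equals `√2` exactly. -/
theorem quadratic_fidelity_mean_std_ratio
    (v : ℝ≥0) (hv : 0 < v) (c : ℝ) (hc : c < 0)
    (F : ℝ → ℝ) (hF : ∀ x, F x = 1 + c * x ^ 2) :
    (∫ x, F x ∂(gaussianReal 0 v)) = 1 + c * (v : ℝ) ∧
    1 + c * (v : ℝ) < 1 ∧
    Real.sqrt (variance F (gaussianReal 0 v)) = Real.sqrt 2 * |c| * (v : ℝ) ∧
    Real.sqrt (variance F (gaussianReal 0 v)) / (1 - ∫ x, F x ∂(gaussianReal 0 v))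
      = Real.sqrt 2 := by
  obtain rfl : F = fun x ↦ 1 + c * x ^ 2 := funext hF
  have hint := (memLp_sq_gaussianReal 0 v).integrable one_le_two
  have hmean : ∫ x, (1 + c * x ^ 2) ∂(gaussianReal 0 v) = 1 + c * (v : ℝ) := by
    rw [integral_add (integrable_const _) (hint.const_mul c), integral_const_mul,
      integral_sq_gaussianReal_zero]
    simp
  have hstd : Real.sqrt (variance (fun x : ℝ ↦ 1 + c * x ^ 2) (gaussianReal 0 v)) =
      Real.sqrt 2 * |c| * (v : ℝ) := by
    rw [variance_const_add (by fun_prop), variance_const_mul, variance_sq_gaussianReal_zero,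
      show c ^ 2 * (2 * (v : ℝ) ^ 2) = 2 * (c * v) ^ 2 by ring, Real.sqrt_mul zero_le_two,
      Real.sqrt_sq_eq_abs, abs_mul, NNReal.abs_eq, mul_assoc]
  have hcv : c * (v : ℝ) < 0 := mul_neg_of_neg_of_pos hc (NNReal.coe_pos.2 hv)
  refine ⟨hmean, by linarith, hstd, ?_⟩
  rw [hstd, hmean, abs_of_neg hc, div_eq_iff (by linarith)]
  ring
end
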